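/- Let ν be a finite positive Borel measure on [0,∞] with ν({1}) = 0, ∫_{[0,1)} α/(1−α) dν(α) < ∞, ∫_{(1,∞]} α/(α−1) dν(α) < ∞, and ∫_{[0,∞]} α/(1−α) dν(α) ≤ −1 (with the convention α/(1−α) = −1 at α = ∞); equivalently, the negative measure μ = −ν satisfies ∫_{[0,∞]∖{1}} α/(1−α) dμ(α) ≥ 1. Suppose that for every d ∈ ℕ the function f : (ℝ≥0)^d ∖ {0} → ℝ, f(x) = ‖x‖₁ · exp₂( −∫_{[0,∞]} H_α(x/‖x‖₁) dν(α) ), where ‖x‖₁ = ∑_i x_i, is convex. Then the support of ν contains at most one point of (1,∞]; that is, supp(ν) ⊆ [0,1] ∪ {α*} for some α* ∈ (1,∞]. -/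

import Mathlib

open MeasureTheory
open scoped ENNReal

noncomputable section

/-- Base-2 logarithm. -/
def log2 (x : ℝ) : ℝ := Real.logb 2 x

/-- Base-2 exponential. -/
def exp2 (x : ℝ) : ℝ := (2 : ℝ) ^ x

/-- Rényi entropy of order `α ∈ [0,∞]` of a vector `p` on a finite set. -/
def renyi {X : Type*} [Fintype X] (α : ℝ≥0∞) (p : X → ℝ) : ℝ :=
  if α = 0 then log2 (Nat.card {x : X // 0 < p x})
  else if α = 1 then -∑ x, p x * log2 (p x)
  else if α = ⊤ then -log2 (⨆ x, p x)
  else (1 - α.toReal)⁻¹ * log2 (∑ x, p x ^ α.toReal)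

/-- A probability vector on a finite set. -/
def IsProbVec {X : Type*} [Fintype X] (p : X → ℝ) : Prop :=
  (∀ x, 0 ≤ p x) ∧ ∑ x, p x = 1

/-- A doubly stochastic matrix. -/
def DoublyStochastic {X : Type*} [Fintype X] (S : Matrix X X ℝ) : Prop :=
  (∀ i j, 0 ≤ S i j) ∧ (∀ i, ∑ j, S i j = 1) ∧ (∀ j, ∑ i, S i j = 1)

/-- `Q` is obtained from `P` by a conditionally mixing channel. -/
def CondMixed {X Y Y' : Type*} [Fintype X] [Fintype Y] [Fintype Y']
    (P : Matrix X Y ℝ) (Q : Matrix X Y' ℝ) : Prop :=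
  ∃ (k : ℕ) (S : Fin k → Matrix X X ℝ) (D : Fin k → Matrix Y Y' ℝ),
    (∀ i, DoublyStochastic (S i)) ∧
    (∀ i a b, 0 ≤ D i a b) ∧
    (∀ a, ∑ b, ∑ i, D i a b = 1) ∧
    Q = ∑ i, S i * P * D i

/-- A joint probability distribution on finite alphabets, viewed as a matrix. -/
def IsJointProb {X Y : Type*} [Fintype X] [Fintype Y] (P : Matrix X Y ℝ) : Prop :=
  (∀ x y, 0 ≤ P x y) ∧ ∑ x, ∑ y, P x y = 1

/-- Marginal on the conditioning system: the `y`-th column sum. -/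
def margY {X Y : Type*} [Fintype X] (P : Matrix X Y ℝ) (y : Y) : ℝ := ∑ x, P x y

/-- The conditioned distribution (normalized `y`-th column). -/
def condX {X Y : Type*} [Fintype X] (P : Matrix X Y ℝ) (y : Y) : X → ℝ :=
  fun x => P x y / margY P y

/-- The conditional entropy `H_{t,τ}`. -/
def Hbulk {X Y : Type*} [Fintype X] [Fintype Y] (t : ℝ) (τ : Measure ℝ≥0∞)
    (P : Matrix X Y ℝ) : ℝ :=
  t⁻¹ * log2 (∑ y ∈ Finset.univ.filter (fun y => 0 < margY P y),
    margY P y * exp2 (t * ∫ α, renyi α (condX P y) ∂τ))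

/-- The conditional entropy `H_{0,α}`. -/
def HzeroA {X Y : Type*} [Fintype X] [Fintype Y] (α : ℝ≥0∞) (P : Matrix X Y ℝ) : ℝ :=
  ∑ y ∈ Finset.univ.filter (fun y => 0 < margY P y), margY P y * renyi α (condX P y)

/-- The conditional entropy `H_{-∞,τ}`. -/
def HnegInf {X Y : Type*} [Fintype X] [Fintype Y] (τ : Measure ℝ≥0∞)
    (P : Matrix X Y ℝ) : ℝ :=
  sInf ((fun y => ∫ α, renyi α (condX P y) ∂τ) '' {y | 0 < margY P y})

/-- The conditional entropy `H_{+∞,0}`. -/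
def HposInf {X Y : Type*} [Fintype X] [Fintype Y] (P : Matrix X Y ℝ) : ℝ :=
  sSup ((fun y => renyi 0 (condX P y)) '' {y | 0 < margY P y})

/-- The parameter set `𝒟_bulk`. -/
def Dbulk : Set (ℝ × Measure ℝ≥0∞) :=
  {p | p.1 ≠ 0 ∧ IsProbabilityMeasure p.2 ∧
    ∀ (d n n' : ℕ) (P : Matrix (Fin d) (Fin n) ℝ) (Q : Matrix (Fin d) (Fin n') ℝ),
      IsJointProb P → CondMixed P Q → Hbulk p.1 p.2 P ≤ Hbulk p.1 p.2 Q}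

/-- The parameter set `𝒟_{-∞}`. -/
def DnegInf : Set (Measure ℝ≥0∞) :=
  {τ | IsProbabilityMeasure τ ∧
    ∀ (d n n' : ℕ) (P : Matrix (Fin d) (Fin n) ℝ) (Q : Matrix (Fin d) (Fin n') ℝ),
      IsJointProb P → CondMixed P Q → HnegInf τ P ≤ HnegInf τ Q}

/-- `P'` is obtained from `P` by relabeling (injections) and embedding, with zeros elsewhere. -/
def Embeds {X Y X' Y' : Type*} [Fintype X] [Fintype Y] [Fintype X'] [Fintype Y']
    (P : Matrix X Y ℝ) (P' : Matrix X' Y' ℝ) : Prop :=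
  ∃ (f : X ↪ X') (g : Y ↪ Y'),
    (∀ x y, P' (f x) (g y) = P x y) ∧
    (∀ x' y', P' x' y' ≠ 0 → (∃ x, f x = x') ∧ (∃ y, g y = y'))

/-- Conditional majorization: after a common embedding, a conditionally mixing channel maps
(the embedding of) `P` to (the embedding of) `Q`. -/
def CondMajorizes {X Y X' Y' : Type*} [Fintype X] [Fintype Y] [Fintype X'] [Fintype Y']
    (P : Matrix X Y ℝ) (Q : Matrix X' Y' ℝ) : Prop :=
  ∃ (m n n' : ℕ) (P' : Matrix (Fin m) (Fin n) ℝ) (Q' : Matrix (Fin m) (Fin n') ℝ),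
    Embeds P P' ∧ Embeds Q Q' ∧ CondMixed P' Q'

/-- Kronecker product of matrices. -/
def kron {X Y X' Y' : Type*} (P : Matrix X Y ℝ) (Q : Matrix X' Y' ℝ) :
    Matrix (X × X') (Y × Y') ℝ :=
  Matrix.of fun x y => P x.1 y.1 * Q x.2 y.2

/-- `n`-fold Kronecker power of a matrix. -/
def kronPow {X Y : Type*} (P : Matrix X Y ℝ) (n : ℕ) :
    Matrix (Fin n → X) (Fin n → Y) ℝ :=
  Matrix.of fun x y => ∏ i, P (x i) (y i)

/-- Sum of all entries of a matrix. -/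
def totalMass {X Y : Type*} [Fintype X] [Fintype Y] (P : Matrix X Y ℝ) : ℝ :=
  ∑ x, ∑ y, P x y

/-- `α/(1-α)`, with the convention that it equals `-1` at `α = ∞`. -/
def aRatio (α : ℝ≥0∞) : ℝ := if α = ⊤ then -1 else α.toReal / (1 - α.toReal)

/-- `α/(α-1)`, with the convention that it equals `1` at `α = ∞`. -/
def aRatio' (α : ℝ≥0∞) : ℝ := if α = ⊤ then 1 else α.toReal / (α.toReal - 1)

/-- Rényi relative entropy `D_α(p‖r)`. -/
def relRenyi {X : Type*} [Fintype X] (α : ℝ≥0∞) (p r : X → ℝ) : ℝ :=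
  if α = 1 then ∑ x, p x * log2 (p x / r x)
  else if α = ⊤ then log2 (⨆ x, p x / r x)
  else (α.toReal - 1)⁻¹ * log2 (∑ x, p x ^ α.toReal * r x ^ (1 - α.toReal))

/-- The quantity `I_{t,τ}(P‖R)`. -/
def Ibulk {X Y : Type*} [Fintype X] [Fintype Y] (t : ℝ) (τ : Measure ℝ≥0∞)
    (P : Matrix X Y ℝ) (R : X → ℝ) : ℝ :=
  -t⁻¹ * log2 (∑ y ∈ Finset.univ.filter (fun y => 0 < margY P y),
    margY P y * exp2 (-t * ∫ α, relRenyi α (condX P y) R ∂τ))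

/-- The quantity `I_{-∞,τ}(P‖R)`. -/
def InegInf {X Y : Type*} [Fintype X] [Fintype Y] (τ : Measure ℝ≥0∞)
    (P : Matrix X Y ℝ) (R : X → ℝ) : ℝ :=
  sSup ((fun y => ∫ α, relRenyi α (condX P y) R ∂τ) '' {y | 0 < margY P y})

/-- A conditioned `R`-preserving channel maps `P` to `Q`. -/
def CondPreserving {X Y Y' : Type*} [Fintype X] [Fintype Y] [Fintype Y'] (R : X → ℝ)
    (P : Matrix X Y ℝ) (Q : Matrix X Y' ℝ) : Prop :=
  ∃ (k : ℕ) (G : Fin k → Matrix X X ℝ) (D : Fin k → Matrix Y Y' ℝ),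
    (∀ i a b, 0 ≤ G i a b) ∧
    (∀ i b, ∑ a, G i a b = 1) ∧
    (∀ i, (G i).mulVec R = R) ∧
    (∀ i a b, 0 ≤ D i a b) ∧
    (∀ a, ∑ b, ∑ i, D i a b = 1) ∧
    Q = ∑ i, G i * P * D i

/-- Total variation distance between two matrices. -/
def tvDist {X Y : Type*} [Fintype X] [Fintype Y] (P Q : Matrix X Y ℝ) : ℝ :=
  (1 / 2) * ∑ x, ∑ y, |P x y - Q x y|

/-- Coefficient of the log of the power sum. -/
def kc (α : ℝ≥0∞) : ℝ := if α = ⊤ then -1 else (1 - α.toReal)⁻¹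

/-- Log of the power sum, or log of the maximum at `∞`. -/
def nl {X : Type*} [Fintype X] (α : ℝ≥0∞) (x : X → ℝ) : ℝ :=
  if α = ⊤ then Real.logb 2 (⨆ i, x i) else Real.logb 2 (∑ i, x i ^ α.toReal)

lemma sum_pos_aux {X : Type*} [Fintype X] [Nonempty X] (x : X → ℝ) (hx : ∀ i, 0 < x i) :
    0 < ∑ i, x i := Finset.sum_pos (fun i _ => hx i) Finset.univ_nonempty

lemma iSup_pos_aux {X : Type*} [Fintype X] [Nonempty X] (x : X → ℝ) (hx : ∀ i, 0 < x i) :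
    0 < ⨆ i, x i := by
  obtain ⟨i⟩ := ‹Nonempty X›
  exact lt_of_lt_of_le (hx i) (le_ciSup (Set.finite_range x).bddAbove i)

lemma renyi_formula {X : Type*} [Fintype X] [Nonempty X] (x : X → ℝ) (hx : ∀ i, 0 < x i)
    (α : ℝ≥0∞) (hα : α ≠ 1) :
    renyi α (fun i => x i / ∑ j, x j) = kc α * nl α x - aRatio α * Real.logb 2 (∑ j, x j) := by
  have hS := sum_pos_aux x hx
  set S := ∑ j, x j with hSdef
  unfold renyi kc nl aRatio log2
  by_cases h0 : α = 0
  · subst h0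
    have : Nat.card {i : X // 0 < x i / S} = Fintype.card X := by
      rw [← Nat.card_eq_fintype_card]
      exact Nat.card_congr (Equiv.subtypeUnivEquiv (fun i => div_pos (hx i) hS))
    simp only [if_true, this]
    simp
  by_cases ht : α = ⊤
  · subst ht
    have : (⨆ i, x i / S) = (⨆ i, x i) / S := by
      simp only [div_eq_mul_inv]
      rw [Real.iSup_mul_of_nonneg (by positivity)]
    simp only [ENNReal.top_ne_zero, ENNReal.top_ne_one, if_false, if_true, this]
    rw [Real.logb_div (iSup_pos_aux x hx).ne' hS.ne']
    ring
  · simp only [h0, hα, ht, if_false]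
    have : ∑ i, (x i / S) ^ α.toReal = (∑ i, x i ^ α.toReal) / S ^ α.toReal := by
      rw [Finset.sum_div]
      exact Finset.sum_congr rfl fun i _ => Real.div_rpow (hx i).le hS.le _
    rw [this, Real.logb_div (sum_pos_aux _ fun i => Real.rpow_pos_of_pos (hx i) _).ne'
      (Real.rpow_pos_of_pos hS _).ne', Real.logb_rpow_eq_mul_logb_of_pos hS]
    ring

lemma logb_close {a b K : ℝ} (ha : 0 < a) (hb : 0 < b) (hK : 0 < K) (h1 : a ≤ K * b)
    (h2 : b ≤ K * a) : |Real.logb 2 a - Real.logb 2 b| ≤ Real.logb 2 K := by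
  have e1 := Real.logb_le_logb_of_le (b := 2) (by norm_num) ha h1
  have e2 := Real.logb_le_logb_of_le (b := 2) (by norm_num) hb h2
  rw [Real.logb_mul hK.ne' hb.ne'] at e1
  rw [Real.logb_mul hK.ne' ha.ne'] at e2
  rw [abs_le]; constructor <;> linarith

lemma pow_sum_le {X : Type*} [Fintype X] (x y : X → ℝ) (hx : ∀ i, 0 < x i)
    (hy : ∀ i, 0 < y i) {K : ℝ} (hK : 0 < K) (h1 : ∀ i, x i ≤ K * y i) (a : ℝ) (ha : 0 ≤ a) :
    ∑ i, x i ^ a ≤ K ^ a * ∑ i, y i ^ a := by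
  rw [Finset.mul_sum]
  refine Finset.sum_le_sum fun i _ => ?_
  rw [← Real.mul_rpow hK.le (hy i).le]
  exact Real.rpow_le_rpow (hx i).le (h1 i) ha

lemma iSup_le_aux {X : Type*} [Fintype X] [Nonempty X] (x y : X → ℝ)
    {K : ℝ} (hK : 0 < K) (h1 : ∀ i, x i ≤ K * y i) :
    (⨆ i, x i) ≤ K * ⨆ i, y i :=
  ciSup_le fun i => (h1 i).trans
    (mul_le_mul_of_nonneg_left (le_ciSup (Set.finite_range y).bddAbove i) hK.le)

lemma renyi_close {X : Type*} [Fintype X] [Nonempty X] (x y : X → ℝ) (hx : ∀ i, 0 < x i)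
    (hy : ∀ i, 0 < y i) {K : ℝ} (hK : 0 < K) (h1 : ∀ i, x i ≤ K * y i) (h2 : ∀ i, y i ≤ K * x i)
    (α : ℝ≥0∞) (hα : α ≠ 1) :
    |renyi α (fun i => x i / ∑ j, x j) - renyi α (fun i => y i / ∑ j, y j)|
      ≤ |aRatio α| * (2 * Real.logb 2 K) := by
  rw [renyi_formula x hx α hα, renyi_formula y hy α hα]
  have hS : |Real.logb 2 (∑ i, x i) - Real.logb 2 (∑ i, y i)| ≤ Real.logb 2 K := by
    apply logb_close (sum_pos_aux x hx) (sum_pos_aux y hy) hK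
    · simpa using pow_sum_le x y hx hy hK h1 1 (by norm_num)
    · simpa using pow_sum_le y x hy hx hK h2 1 (by norm_num)
  have hN : |kc α| * |nl α x - nl α y| ≤ |aRatio α| * Real.logb 2 K := by
    unfold kc nl aRatio
    by_cases ht : α = ⊤
    · simp only [ht, if_true]
      have := logb_close (iSup_pos_aux x hx) (iSup_pos_aux y hy) hK (iSup_le_aux x y hK h1)
        (iSup_le_aux y x hK h2)
      simpa using this
    · simp only [ht, if_false]
      have ha : 0 ≤ α.toReal := ENNReal.toReal_nonneg
      have := logb_close (sum_pos_aux _ fun i => Real.rpow_pos_of_pos (hx i) α.toReal)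
        (sum_pos_aux _ fun i => Real.rpow_pos_of_pos (hy i) α.toReal)
        (Real.rpow_pos_of_pos hK α.toReal)
        (pow_sum_le x y hx hy hK h1 _ ha) (pow_sum_le y x hy hx hK h2 _ ha)
      rw [Real.logb_rpow_eq_mul_logb_of_pos hK] at this
      rw [abs_div, abs_of_nonneg ha, div_eq_inv_mul, abs_inv, mul_assoc]
      exact mul_le_mul_of_nonneg_left this (by positivity)
  have e : kc α * nl α x - aRatio α * Real.logb 2 (∑ j, x j) -
      (kc α * nl α y - aRatio α * Real.logb 2 (∑ j, y j))
      = kc α * (nl α x - nl α y) -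
        aRatio α * (Real.logb 2 (∑ i, x i) - Real.logb 2 (∑ i, y i)) := by ring
  rw [e]
  refine (abs_sub _ _).trans ?_
  rw [abs_mul, abs_mul]
  have := mul_le_mul_of_nonneg_left hS (abs_nonneg (aRatio α))
  linarith

lemma renyi_const {X : Type*} [Fintype X] [Nonempty X] (α : ℝ≥0∞) (hα : α ≠ 1) :
    renyi α (fun _ : X => (1 : ℝ) / ∑ _j : X, (1 : ℝ)) = Real.logb 2 (Fintype.card X) := by
  rw [renyi_formula (fun _ => 1) (fun _ => one_pos) α hα]
  unfold kc nl aRatio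
  by_cases ht : α = ⊤
  · simp [ht]
  · simp only [ht, if_false]
    have h : 1 - α.toReal ≠ 0 := by
      intro h
      apply hα
      rw [← ENNReal.toReal_eq_one_iff]; linarith
    simp
    field_simp
    

lemma measurable_renyi {X : Type*} [Fintype X] (p : X → ℝ) :
    Measurable (fun α => renyi α p) := by
  unfold renyi log2
  refine Measurable.ite (measurableSet_singleton _) measurable_const ?_
  refine Measurable.ite (measurableSet_singleton _) measurable_const ?_
  refine Measurable.ite (measurableSet_singleton _) measurable_const ?_
  unfold Real.logb
  fun_prop

lemma ae_ne_one (ν : Measure ℝ≥0∞) (h1 : ν {1} = 0) : ∀ᵐ α ∂ν, α ≠ 1 := by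
  rw [ae_iff]; simpa using h1

lemma integrable_aRatio (ν : Measure ℝ≥0∞) (h1 : ν {1} = 0)
    (h2 : IntegrableOn aRatio (Set.Iio 1) ν) (h3 : IntegrableOn aRatio' (Set.Ioi 1) ν) :
    Integrable aRatio ν := by
  have h3' : IntegrableOn aRatio (Set.Ioi 1) ν := by
    have : aRatio = fun α => - aRatio' α := by
      funext α
      unfold aRatio aRatio'
      split_ifs
      · rfl
      · rw [← div_neg, neg_sub]
    rw [this]; exact h3.neg
  have h := h2.union h3'
  have h' : IntegrableOn aRatio {1} ν := by
    rw [IntegrableOn, Measure.restrict_eq_zero.2 h1]; exact integrable_zero_measure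
  rw [← integrableOn_univ]
  refine (h.union h').mono_set ?_
  intro α _
  rcases lt_trichotomy α 1 with h | h | h
  · exact Or.inl (Or.inl h)
  · exact Or.inr h
  · exact Or.inl (Or.inr h)

lemma integrable_renyi (ν : Measure ℝ≥0∞) [IsFiniteMeasure ν] (h1 : ν {1} = 0)
    (hA : Integrable aRatio ν) {X : Type*} [Fintype X] [Nonempty X] (x : X → ℝ)
    (hx : ∀ i, 0 < x i) : Integrable (fun α => renyi α (fun i => x i / ∑ j, x j)) ν := by
  obtain ⟨K, hK, hK1, hK2⟩ : ∃ K : ℝ, 0 < K ∧ (∀ i, x i ≤ K * 1) ∧ ∀ i, 1 ≤ K * x i := by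
    refine ⟨∑ i, (x i + (x i)⁻¹), sum_pos_aux _ fun i => ?_, fun i => ?_, fun i => ?_⟩
    · have := hx i; positivity
    all_goals
      have hh : x i + (x i)⁻¹ ≤ ∑ i, (x i + (x i)⁻¹) :=
        Finset.single_le_sum (f := fun i => x i + (x i)⁻¹)
          (fun j _ => by have := hx j; positivity) (Finset.mem_univ i)
      have h0 := hx i
      have h0' : 0 < (x i)⁻¹ := by positivity
    · linarith
    · have : 1 = (x i)⁻¹ * x i := by field_simp
      calc 1 = (x i)⁻¹ * x i := this
        _ ≤ _ := mul_le_mul_of_nonneg_right (by linarith) h0.le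
  have hb : Integrable (fun α => |aRatio α| * (2 * Real.logb 2 K) +
      |Real.logb 2 (Fintype.card X)|) ν :=
    (hA.abs.mul_const _).add (integrable_const _)
  refine hb.mono' (measurable_renyi _).aestronglyMeasurable ?_
  filter_upwards [ae_ne_one ν h1] with α hα
  have := renyi_close x (fun _ => 1) hx (fun _ => one_pos) hK hK1 hK2 α hα
  rw [renyi_const α hα] at this
  rw [Real.norm_eq_abs]
  have h' := abs_sub_abs_le_abs_sub (renyi α fun i => x i / ∑ j, x j)
    (Real.logb 2 (Fintype.card X))
  linarith

/-- The function of the theorem on an arbitrary finite index type. -/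
def Phi (ν : Measure ℝ≥0∞) {X : Type*} [Fintype X] (x : X → ℝ) : ℝ :=
  (∑ i, x i) * exp2 (-∫ α, renyi α (fun i => x i / ∑ j, x j) ∂ν)

lemma renyi_comp {X Y : Type*} [Fintype X] [Fintype Y] (e : Y ≃ X) (p : X → ℝ) (α : ℝ≥0∞) :
    renyi α (fun i => p (e i)) = renyi α p := by
  unfold renyi
  rw [Equiv.sum_comp e (fun i => p i * log2 (p i)), Equiv.sum_comp e (fun i => p i ^ α.toReal),
    Equiv.iSup_comp (g := p) e,
    Nat.card_congr (e.subtypeEquiv (fun _ => Iff.rfl) : {i // 0 < p (e i)} ≃ {i // 0 < p i})]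

lemma Phi_comp (ν : Measure ℝ≥0∞) {X Y : Type*} [Fintype X] [Fintype Y] (e : Y ≃ X)
    (x : X → ℝ) : Phi ν (fun i => x (e i)) = Phi ν x := by
  unfold Phi
  rw [Equiv.sum_comp e x]
  congr 4
  funext α
  exact renyi_comp e (fun i => x i / ∑ j, x j) α

lemma Phi_mid (ν : Measure ℝ≥0∞)
    (hconv : ∀ d : ℕ, ConvexOn ℝ {x : Fin d → ℝ | (∀ i, 0 ≤ x i) ∧ x ≠ 0}
      (fun x => (∑ i, x i) * exp2 (-∫ α, renyi α (fun i => x i / ∑ j, x j) ∂ν)))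
    {X : Type*} [Fintype X] [Nonempty X] (x y z : X → ℝ) (hx : ∀ i, 0 < x i)
    (hy : ∀ i, 0 < y i) (hz : ∀ i, z i = (1 / 2) * x i + (1 / 2) * y i) :
    Phi ν z ≤ (1 / 2) * Phi ν x + (1 / 2) * Phi ν y := by
  let e := (Fintype.equivFin X).symm
  have hmem : ∀ u : X → ℝ, (∀ i, 0 < u i) → (fun i => u (e i)) ∈
      {x : Fin (Fintype.card X) → ℝ | (∀ i, 0 ≤ x i) ∧ x ≠ 0} := by
    intro u hu
    refine ⟨fun i => (hu _).le, fun h => ?_⟩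
    obtain ⟨i⟩ := ‹Nonempty X›
    have := congrFun h (e.symm i)
    simp at this
    exact (hu i).ne' this
  have := (hconv (Fintype.card X)).2 (hmem x hx) (hmem y hy)
    (show (0 : ℝ) ≤ 1 / 2 by norm_num) (show (0 : ℝ) ≤ 1 / 2 by norm_num) (by norm_num)
  have hzz : (fun i => z (e i)) = (1 / 2 : ℝ) • (fun i => x (e i)) +
      (1 / 2 : ℝ) • (fun i => y (e i)) := by
    funext i; simp [hz]
  rw [← hzz] at this
  rw [← Phi_comp ν e x, ← Phi_comp ν e y, ← Phi_comp ν e z]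
  exact this

lemma exists_nonatom (ν : Measure ℝ≥0∞) [IsFiniteMeasure ν] (a b : ℝ≥0∞) (hab : a < b) :
    ∃ r : ℝ, 0 ≤ r ∧ a < ENNReal.ofReal r ∧ ENNReal.ofReal r < b ∧
      ν {ENNReal.ofReal r} = 0 := by
  obtain ⟨p, hap, hpb⟩ := ENNReal.lt_iff_exists_nnreal_btwn.1 hab
  obtain ⟨q, hpq, hqb⟩ := ENNReal.lt_iff_exists_nnreal_btwn.1 hpb
  have hpq' : (p : ℝ) < q := by exact_mod_cast hpq
  have hc := Measure.countable_meas_pos_of_disjoint_iUnion (μ := ν)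
    (As := fun r : Set.Ioo (p : ℝ) q => {ENNReal.ofReal r.1})
    (fun _ => measurableSet_singleton _) (by
      intro r s hrs
      simp only [Function.onFun, Set.disjoint_singleton]
      intro h
      apply hrs
      have hr := r.2.1
      have hs := s.2.1
      have hp := p.2
      exact Subtype.ext ((ENNReal.ofReal_eq_ofReal_iff (hp.trans hr.le) (hp.trans hs.le)).1 h))
  by_contra hcon
  push Not at hcon
  have huniv : {r : Set.Ioo (p : ℝ) q | 0 < ν {ENNReal.ofReal r.1}} = Set.univ := by
    ext r
    simp only [Set.mem_ofPred_eq, Set.mem_univ, iff_true]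
    have h0 : (0 : ℝ) ≤ r.1 := p.2.trans r.2.1.le
    refine pos_iff_ne_zero.2 (hcon r.1 h0 ?_ ?_)
    · refine hap.trans ?_
      rw [← ENNReal.ofReal_coe_nnreal]
      exact (ENNReal.ofReal_lt_ofReal_iff_of_nonneg p.2).2 r.2.1
    · refine lt_trans ?_ hqb
      rw [← ENNReal.ofReal_coe_nnreal]
      exact (ENNReal.ofReal_lt_ofReal_iff_of_nonneg h0).2 r.2.2
  rw [huniv, Set.countable_univ_iff] at hc
  have : Cardinal.mk (Set.Ioo (p : ℝ) q) ≤ Cardinal.aleph0 := Cardinal.mk_le_aleph0_iff.2 hc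
  rw [Cardinal.mk_Ioo_real hpq'] at this
  exact absurd this (not_le.2 Cardinal.aleph0_lt_continuum)

lemma exists_split (ν : Measure ℝ≥0∞) [IsFiniteMeasure ν]
    (h : ¬ ∃ αstar : ℝ≥0∞, 1 < αstar ∧ ν {α | 1 < α ∧ α ≠ αstar} = 0) :
    ∃ b c : ℝ, 1 < b ∧ b < c ∧ ν {ENNReal.ofReal b} = 0 ∧ ν {ENNReal.ofReal c} = 0 ∧
      0 < ν (Set.Ioo (ENNReal.ofReal b) (ENNReal.ofReal c)) ∧
      0 < ν (Set.Ioi (ENNReal.ofReal c)) := by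
  have hs : ∃ α1 ∈ ν.support, ∃ α2 ∈ ν.support, 1 < α1 ∧ α1 < α2 := by
    by_contra hcon
    push Not at hcon
    apply h
    by_cases hne : ∃ α ∈ ν.support, 1 < α
    · obtain ⟨α, hα, h1⟩ := hne
      refine ⟨α, h1, measure_mono_null ?_ (Measure.measure_compl_support (μ := ν))⟩
      rintro β ⟨hβ1, hβ⟩ hβs
      exact hβ (le_antisymm (hcon α hα β hβs h1) (hcon β hβs α hα hβ1))
    · push Not at hne
      refine ⟨2, by norm_num, measure_mono_null ?_ (Measure.measure_compl_support (μ := ν))⟩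
      rintro β ⟨hβ1, hβ⟩ hβs
      exact absurd hβ1 (not_lt.2 (hne β hβs))
  obtain ⟨α1, h1s, α2, h2s, h1, h12⟩ := hs
  obtain ⟨b, hb0, hb1, hb2, hb⟩ := exists_nonatom ν 1 α1 h1
  obtain ⟨c, hc0, hc1, hc2, hc⟩ := exists_nonatom ν α1 α2 h12
  refine ⟨b, c, by simpa using hb1, ?_, hb, hc, ?_, ?_⟩
  · exact (ENNReal.ofReal_lt_ofReal_iff_of_nonneg hb0).1 (hb2.trans hc1)
  · exact (Measure.mem_support_iff_forall α1).1 h1s _ (Ioo_mem_nhds hb2 hc1)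
  · exact (Measure.mem_support_iff_forall α2).1 h2s _ (Ioi_mem_nhds hc2)

open Filter Topology

lemma lim3 (A B C : ℕ → ℝ) (hA : ∀ n, 0 < A n) (hB : Tendsto (fun n => B n / A n) atTop (𝓝 0))
    (hC : Tendsto (fun n => C n / A n) atTop (𝓝 0)) (p q r : ℝ) :
    Tendsto (fun n => (p * A n + q * B n + r * C n) / (A n + B n + C n)) atTop (𝓝 p) := by
  have h : Tendsto (fun n => (p + q * (B n / A n) + r * (C n / A n)) /
      (1 + B n / A n + C n / A n)) atTop (𝓝 ((p + q * 0 + r * 0) / (1 + 0 + 0))) := by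
    refine Tendsto.div ?_ ?_ (by norm_num)
    · exact ((hB.const_mul q).const_add p).add (hC.const_mul r)
    · exact (hB.const_add 1).add hC
  simp only [mul_zero, add_zero, div_one] at h
  refine h.congr fun n => ?_
  have := (hA n).ne'
  have e1 : p * A n + q * B n + r * C n = A n * (p + q * (B n / A n) + r * (C n / A n)) := by
    field_simp
  have e2 : A n + B n + C n = A n * (1 + B n / A n + C n / A n) := by field_simp
  rw [e1, e2, mul_div_mul_left _ _ this]

/-- Index type of the test vectors. -/
abbrev IX (n : ℕ) : Type := Fin ((n + 1) ^ 2) ⊕ (Fin (n + 1) ⊕ Unit)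

/-- The test vectors, with three flat blocks. -/
def tv (b c : ℝ) (n : ℕ) (t2 t3 : ℝ) : IX n → ℝ :=
  Sum.elim (fun _ => ((n : ℝ) + 1) ^ (-(1 / b) - 1 / c))
    (Sum.elim (fun _ => t2 * ((n : ℝ) + 1) ^ (-(1 / c))) (fun _ => t3))

lemma tv_pos (b c : ℝ) (n : ℕ) (t2 t3 : ℝ) (h2 : 0 < t2) (h3 : 0 < t3) (i : IX n) :
    0 < tv b c n t2 t3 i := by
  rcases i with i | i | i <;> simp only [tv, Sum.elim_inl, Sum.elim_inr] <;> positivity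

lemma tv_sum (b c : ℝ) (n : ℕ) (t2 t3 : ℝ) (h2 : 0 < t2) (a : ℝ) :
    ∑ i, tv b c n t2 t3 i ^ a = 1 * ((n : ℝ) + 1) ^ (2 - a / b - a / c) +
      t2 ^ a * ((n : ℝ) + 1) ^ (1 - a / c) + t3 ^ a * 1 := by
  have hN : (0 : ℝ) < (n : ℝ) + 1 := by positivity
  simp only [Fintype.sum_sum_type, tv, Sum.elim_inl, Sum.elim_inr, Finset.sum_const,
    Finset.card_univ, Fintype.card_fin, nsmul_eq_mul, Fintype.card_unit]
  rw [Real.mul_rpow h2.le (by positivity), ← Real.rpow_mul hN.le, ← Real.rpow_mul hN.le]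
  have e1 : ((n : ℝ) + 1) ^ (2 - a / b - a / c) =
      ((n : ℝ) + 1) ^ 2 * ((n : ℝ) + 1) ^ ((-(1 / b) - 1 / c) * a) := by
    rw [← Real.rpow_natCast, ← Real.rpow_add hN]; congr 1; push_cast; ring
  have e2 : ((n : ℝ) + 1) ^ (1 - a / c) =
      ((n : ℝ) + 1) * ((n : ℝ) + 1) ^ (-(1 / c) * a) := by
    nth_rewrite 2 [← Real.rpow_one ((n : ℝ) + 1)]
    rw [← Real.rpow_add hN]; congr 1; ring
  rw [e1, e2]; push_cast; ring

lemma tendsto_rpow_neg' (e : ℝ) (he : e < 0) :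
    Tendsto (fun n : ℕ => ((n : ℝ) + 1) ^ e) atTop (𝓝 0) := by
  have h := tendsto_rpow_neg_atTop (y := -e) (by linarith)
  simp only [neg_neg] at h
  exact h.comp (tendsto_atTop_add_const_right _ _ tendsto_natCast_atTop_atTop)

lemma tendsto_div_pow (e f : ℝ) (he : e < f) :
    Tendsto (fun n : ℕ => ((n : ℝ) + 1) ^ e / ((n : ℝ) + 1) ^ f) atTop (𝓝 0) := by
  refine (tendsto_rpow_neg' (e - f) (by linarith)).congr fun n => ?_
  rw [Real.rpow_sub (by positivity)]

/-- The dominating block, as a factor. -/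
def dom (b c t2 t3 a : ℝ) : ℝ := if a < b then 1 else if a < c then t2 else t3

lemma dom_pos (b c t2 t3 a : ℝ) (h2 : 0 < t2) (h3 : 0 < t3) : 0 < dom b c t2 t3 a := by
  unfold dom; split_ifs <;> linarith

lemma ratio_lim (b c t2 t3 a : ℝ) (hb : 1 < b) (hbc : b < c) (h2 : 0 < t2)
    (hab : a ≠ b) (hac : a ≠ c) :
    Tendsto (fun n => (∑ i, tv b c n t2 t3 i ^ a) / ∑ i, tv b c n 1 1 i ^ a) atTop
      (𝓝 (dom b c t2 t3 a ^ a)) := by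
  simp only [tv_sum b c _ t2 t3 h2, tv_sum b c _ 1 1 one_pos, Real.one_rpow, one_mul, mul_one]
  have hb0 : 0 < b := by linarith
  have hc0 : 0 < c := by linarith
  have hpos : ∀ e : ℝ, ∀ n : ℕ, 0 < ((n : ℝ) + 1) ^ e := fun e n => by positivity
  have one : ∀ n : ℕ, ((n : ℝ) + 1) ^ (0 : ℝ) = 1 := fun n => Real.rpow_zero _
  unfold dom
  split_ifs with hlt hlt2
  · have i1 : a / b < 1 := by rw [div_lt_one hb0]; exact hlt
    have i2 : a / c < 1 := by rw [div_lt_one hc0]; linarith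
    have := lim3 _ _ _ (hpos (2 - a / b - a / c))
      (tendsto_div_pow (1 - a / c) (2 - a / b - a / c) (by linarith))
      (tendsto_div_pow 0 (2 - a / b - a / c) (by linarith)) 1 (t2 ^ a) (t3 ^ a)
    rw [Real.one_rpow]
    refine this.congr fun n => ?_
    simp only [one]; ring
  · have i1 : 1 < a / b := by
      rw [one_lt_div hb0]; exact lt_of_le_of_ne (not_lt.1 hlt) hab.symm
    have i2 : a / c < 1 := by rw [div_lt_one hc0]; linarith
    have := lim3 _ _ _ (hpos (1 - a / c))
      (tendsto_div_pow (2 - a / b - a / c) (1 - a / c) (by linarith))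
      (tendsto_div_pow 0 (1 - a / c) (by linarith)) (t2 ^ a) 1 (t3 ^ a)
    refine this.congr fun n => ?_
    simp only [one]
    congr 1 <;> ring
  · have hca : c < a := lt_of_le_of_ne (not_lt.1 hlt2) hac.symm
    have i1 : 1 < a / b := by rw [one_lt_div hb0]; linarith
    have i2 : 1 < a / c := by rw [one_lt_div hc0]; linarith
    have := lim3 _ _ _ (hpos 0)
      (tendsto_div_pow (2 - a / b - a / c) 0 (by linarith))
      (tendsto_div_pow (1 - a / c) 0 (by linarith)) (t3 ^ a) 1 (t2 ^ a)
    refine this.congr fun n => ?_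
    simp only [one]
    congr 1 <;> ring

lemma tv_iSup (b c t2 t3 : ℝ) (hb : 1 < b) (hbc : b < c) (h3 : 0 < t3) :
    ∀ᶠ n : ℕ in atTop, (⨆ i, tv b c n t2 t3 i) = t3 := by
  have hb0 : 0 < 1 / b := by have : 0 < b := by linarith
                             positivity
  have hc0 : 0 < 1 / c := by have : 0 < c := by linarith
                             positivity
  have l1 := tendsto_rpow_neg' (-(1 / b) - 1 / c) (by linarith)
  have l2 := (tendsto_rpow_neg' (-(1 / c)) (by linarith)).const_mul t2
  rw [mul_zero] at l2
  filter_upwards [l1.eventually (gt_mem_nhds h3), l2.eventually (gt_mem_nhds h3)] with n g1 g2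
  apply le_antisymm
  · apply ciSup_le
    rintro (i | i | i) <;> simp only [tv, Sum.elim_inl, Sum.elim_inr]
    · exact g1.le
    · exact g2.le
    · exact le_rfl
  · exact le_ciSup (f := fun i => tv b c n t2 t3 i) (Set.finite_range _).bddAbove
      (Sum.inr (Sum.inr ()))

/-- Limit profile. -/
def prof (b c t2 t3 : ℝ) (α : ℝ≥0∞) : ℝ :=
  if α = ⊤ then t3 else dom b c t2 t3 α.toReal

lemma nl_lim (b c t2 t3 : ℝ) (hb : 1 < b) (hbc : b < c) (h2 : 0 < t2) (h3 : 0 < t3)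
    (α : ℝ≥0∞) (hab : α ≠ ENNReal.ofReal b) (hac : α ≠ ENNReal.ofReal c) :
    Tendsto (fun n => kc α * (nl α (tv b c n t2 t3) - nl α (tv b c n 1 1))) atTop
      (𝓝 (aRatio α * Real.logb 2 (prof b c t2 t3 α))) := by
  by_cases ht : α = ⊤
  · subst ht
    simp only [kc, nl, aRatio, prof, if_true]
    apply tendsto_const_nhds.congr'
    filter_upwards [tv_iSup b c t2 t3 hb hbc h3, tv_iSup b c 1 1 hb hbc one_pos] with n e1 e2
    rw [e1, e2]; simp
  · simp only [kc, nl, aRatio, prof, ht, if_false]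
    have hab' : α.toReal ≠ b := by
      rintro rfl; exact hab (ENNReal.ofReal_toReal ht).symm
    have hac' : α.toReal ≠ c := by
      rintro rfl; exact hac (ENNReal.ofReal_toReal ht).symm
    have hd := dom_pos b c t2 t3 α.toReal h2 h3
    have := ratio_lim b c t2 t3 α.toReal hb hbc h2 hab' hac'
    have h' := ((Real.continuousAt_logb (b := 2)
      (Real.rpow_pos_of_pos hd α.toReal).ne').tendsto.comp this).const_mul (1 - α.toReal)⁻¹
    rw [Real.logb_rpow_eq_mul_logb_of_pos hd, ← mul_assoc, ← div_eq_inv_mul] at h'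
    refine h'.congr fun n => ?_
    simp only [Function.comp]
    rw [Real.logb_div]
    · exact (sum_pos_aux _ fun i => Real.rpow_pos_of_pos (tv_pos b c n t2 t3 h2 h3 i) _).ne'
    · exact (sum_pos_aux _ fun i =>
        Real.rpow_pos_of_pos (tv_pos b c n 1 1 one_pos one_pos i) _).ne'

/-- Logarithm of `Phi`. -/
def LL (ν : Measure ℝ≥0∞) {X : Type*} [Fintype X] (x : X → ℝ) : ℝ :=
  Real.logb 2 (∑ i, x i) - ∫ α, renyi α (fun i => x i / ∑ j, x j) ∂ν

lemma Phi_eq (ν : Measure ℝ≥0∞) {X : Type*} [Fintype X] [Nonempty X] (x : X → ℝ)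
    (hx : ∀ i, 0 < x i) : Phi ν x = 2 ^ LL ν x := by
  unfold Phi LL exp2
  rw [sub_eq_add_neg, Real.rpow_add (by norm_num),
    Real.rpow_logb (by norm_num) (by norm_num) (sum_pos_aux x hx)]

lemma S_lim (b c t2 t3 : ℝ) (hb : 1 < b) (hbc : b < c) (h2 : 0 < t2) (h3 : 0 < t3) :
    Tendsto (fun n => Real.logb 2 (∑ i, tv b c n t2 t3 i) - Real.logb 2 (∑ i, tv b c n 1 1 i))
      atTop (𝓝 0) := by
  have := ratio_lim b c t2 t3 1 hb hbc h2 hb.ne (hb.trans hbc).ne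
  simp only [Real.rpow_one, dom, hb, if_true] at this
  have h' := (Real.continuousAt_logb (b := 2) one_ne_zero).tendsto.comp this
  rw [Real.logb_one] at h'
  refine h'.congr fun n => ?_
  simp only [Function.comp]
  rw [Real.logb_div]
  · exact (sum_pos_aux _ fun i => tv_pos b c n t2 t3 h2 h3 i).ne'
  · exact (sum_pos_aux _ fun i => tv_pos b c n 1 1 one_pos one_pos i).ne'

lemma tv_close (b c : ℝ) (n : ℕ) (s2 s3 t2 t3 : ℝ) (h2 : s2 ≤ 2 * t2)
    (h3 : s3 ≤ 2 * t3) (i : IX n) : tv b c n s2 s3 i ≤ 2 * tv b c n t2 t3 i := by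
  have hp : ∀ e : ℝ, 0 < ((n : ℝ) + 1) ^ e := fun e => by positivity
  rcases i with i | i | i <;> simp only [tv, Sum.elim_inl, Sum.elim_inr]
  · have := hp (-(1 / b) - 1 / c); linarith
  · have := mul_le_mul_of_nonneg_right h2 (hp (-(1 / c))).le; linarith
  · exact h3

lemma LL_lim (ν : Measure ℝ≥0∞) [IsFiniteMeasure ν] (hone : ν {1} = 0)
    (hA : Integrable aRatio ν) (b c t2 t3 : ℝ) (hb : 1 < b) (hbc : b < c)
    (hνb : ν {ENNReal.ofReal b} = 0) (hνc : ν {ENNReal.ofReal c} = 0)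
    (h2 : 1 / 2 ≤ t2) (h2' : t2 ≤ 2) (h3 : 1 / 2 ≤ t3) (h3' : t3 ≤ 2) :
    Tendsto (fun n => LL ν (tv b c n t2 t3) - LL ν (tv b c n 1 1)) atTop
      (𝓝 (-∫ α, aRatio α * Real.logb 2 (prof b c t2 t3 α) ∂ν)) := by
  have p2 : 0 < t2 := by linarith
  have p3 : 0 < t3 := by linarith
  have hpx := fun n => tv_pos b c n t2 t3 p2 p3
  have hp1 := fun n => tv_pos b c n 1 1 one_pos one_pos
  have hS := S_lim b c t2 t3 hb hbc p2 p3
  have hI : Tendsto (fun n => ∫ α, (renyi α (fun i => tv b c n t2 t3 i / ∑ j, tv b c n t2 t3 j) -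
      renyi α (fun i => tv b c n 1 1 i / ∑ j, tv b c n 1 1 j)) ∂ν) atTop
      (𝓝 (∫ α, aRatio α * Real.logb 2 (prof b c t2 t3 α) ∂ν)) := by
    refine tendsto_integral_of_dominated_convergence
      (fun α => |aRatio α| * (2 * Real.logb 2 2)) ?_ (hA.abs.mul_const _) ?_ ?_
    · intro n
      exact ((measurable_renyi _).sub (measurable_renyi _)).aestronglyMeasurable
    · intro n
      filter_upwards [ae_ne_one ν hone] with α hα
      exact renyi_close _ _ (hpx n) (hp1 n) two_pos
        (tv_close b c n t2 t3 1 1 (by linarith) (by linarith))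
        (tv_close b c n 1 1 t2 t3 (by linarith) (by linarith)) α hα
    · have aeb : ∀ᵐ α ∂ν, α ≠ ENNReal.ofReal b := by rw [ae_iff]; simpa using hνb
      have aec : ∀ᵐ α ∂ν, α ≠ ENNReal.ofReal c := by rw [ae_iff]; simpa using hνc
      filter_upwards [ae_ne_one ν hone, aeb, aec] with α hα hαb hαc
      have := (nl_lim b c t2 t3 hb hbc p2 p3 α hαb hαc).sub (hS.const_mul (aRatio α))
      rw [mul_zero, sub_zero] at this
      refine this.congr fun n => ?_
      rw [renyi_formula _ (hpx n) α hα, renyi_formula _ (hp1 n) α hα]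
      ring
  have := hS.sub hI
  rw [zero_sub] at this
  refine this.congr fun n => ?_
  rw [integral_sub (integrable_renyi ν hone hA _ (hpx n)) (integrable_renyi ν hone hA _ (hp1 n))]
  unfold LL
  ring

lemma prof_integral (ν : Measure ℝ≥0∞) (hA : Integrable aRatio ν)
    (b c t2 t3 : ℝ) (hb : 1 < b) (hbc : b < c)
    (hνb : ν {ENNReal.ofReal b} = 0) (hνc : ν {ENNReal.ofReal c} = 0) :
    -∫ α, aRatio α * Real.logb 2 (prof b c t2 t3 α) ∂ν =
      (∫ α in Set.Ioo (ENNReal.ofReal b) (ENNReal.ofReal c), -aRatio α ∂ν) * Real.logb 2 t2 +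
      (∫ α in Set.Ioi (ENNReal.ofReal c), -aRatio α ∂ν) * Real.logb 2 t3 := by
  have aeb : ∀ᵐ α ∂ν, α ≠ ENNReal.ofReal b := by rw [ae_iff]; simpa using hνb
  have aec : ∀ᵐ α ∂ν, α ≠ ENNReal.ofReal c := by rw [ae_iff]; simpa using hνc
  rw [← integral_indicator measurableSet_Ioo, ← integral_indicator measurableSet_Ioi,
    ← integral_mul_const, ← integral_mul_const, ← integral_neg, ← integral_add]
  · apply integral_congr_ae
    filter_upwards [aeb, aec] with α hαb hαc
    by_cases ht : α = ⊤
    · subst ht; simp [prof]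
    · obtain ⟨r, hr, rfl⟩ : ∃ r : ℝ, 0 ≤ r ∧ α = ENNReal.ofReal r :=
        ⟨α.toReal, ENNReal.toReal_nonneg, (ENNReal.ofReal_toReal ht).symm⟩
      have hb0 : 0 ≤ b := by linarith
      have hc0 : 0 ≤ c := by linarith
      have hrb : r ≠ b := fun h => hαb (by rw [h])
      have hrc : r ≠ c := fun h => hαc (by rw [h])
      simp only [prof, ht, if_false, ENNReal.toReal_ofReal hr, Set.indicator, Set.mem_Ioo,
        Set.mem_Ioi, ENNReal.ofReal_lt_ofReal_iff_of_nonneg hr,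
        ENNReal.ofReal_lt_ofReal_iff_of_nonneg hb0, ENNReal.ofReal_lt_ofReal_iff_of_nonneg hc0]
      unfold dom
      rcases lt_or_gt_of_ne hrb with h | h
      · have h1 : ¬ b < r := by linarith
        have h2 : ¬ c < r := by linarith
        simp [h, h1, h2]
      · have h1 : ¬ r < b := by linarith
        rcases lt_or_gt_of_ne hrc with h' | h'
        · have h2 : ¬ c < r := by linarith
          simp [h, h1, h', h2]
        · have h2 : ¬ r < c := by linarith
          simp [h1, h', h2]
  · exact (hA.neg.indicator measurableSet_Ioo).mul_const _
  · exact (hA.neg.indicator measurableSet_Ioi).mul_const _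

lemma aRatio_neg (α : ℝ≥0∞) (h : 1 < α) : 0 < -aRatio α := by
  unfold aRatio
  split_ifs with ht
  · norm_num
  · have : 1 < α.toReal := by
      rw [← ENNReal.toReal_one]
      exact (ENNReal.toReal_lt_toReal ENNReal.one_ne_top ht).2 h
    rw [← div_neg, neg_sub]
    exact div_pos (by linarith) (by linarith)

lemma theta_pos (ν : Measure ℝ≥0∞) (hA : Integrable aRatio ν) (s : Set ℝ≥0∞)
    (hsm : MeasurableSet s) (hs : ∀ α ∈ s, 1 < α) (hpos : 0 < ν s) :
    0 < ∫ α in s, -aRatio α ∂ν := by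
  rw [setIntegral_pos_iff_support_of_nonneg_ae]
  · refine hpos.trans_le (measure_mono fun α hα => ⟨?_, hα⟩)
    exact (aRatio_neg α (hs α hα)).ne'
  · filter_upwards [ae_restrict_mem hsm] with α hα
    exact (aRatio_neg α (hs α hα)).le
  · exact hA.neg.integrableOn

lemma log_neg_aux (p q s : ℝ) (hp : 0 < p) (hq : 0 < q) (hs : s ≠ 0) (h1 : 0 < 1 + s * q)
    (h2 : 0 < 1 - s * p) :
    p * Real.logb 2 (1 + s * q) + q * Real.logb 2 (1 - s * p) < 0 := by
  have hsq : s * q ≠ 0 := mul_ne_zero hs hq.ne'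
  have hsp : s * p ≠ 0 := mul_ne_zero hs hp.ne'
  have e1 := Real.log_lt_sub_one_of_pos h1 (by intro h; apply hsq; linarith)
  have e2 := Real.log_lt_sub_one_of_pos h2 (by intro h; apply hsp; linarith)
  have l2 : 0 < Real.log 2 := Real.log_pos (by norm_num)
  unfold Real.logb
  have : p * (Real.log (1 + s * q) / Real.log 2) + q * (Real.log (1 - s * p) / Real.log 2) =
    (p * Real.log (1 + s * q) + q * Real.log (1 - s * p)) / Real.log 2 := by ring
  rw [this]
  apply div_neg_of_neg_of_pos _ l2
  nlinarith [mul_lt_mul_of_pos_left e1 hp, mul_lt_mul_of_pos_left e2 hq]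

/-- Necessary conditions for convexity (negative-measure case): if
`x ↦ ‖x‖₁ · 2^(-∫ H_α(x/‖x‖₁) dν(α))` is convex on `(ℝ≥0)^d ∖ {0}` for every `d`, then the
support of `ν` contains at most one point of `(1,∞]`, i.e. `ν` vanishes outside
`[0,1] ∪ {α*}` for some `α* ∈ (1,∞]`. -/
theorem necessary_conditions_convex (ν : Measure ℝ≥0∞) (hfin : IsFiniteMeasure ν)
    (h1 : ν {1} = 0)
    (h2 : IntegrableOn aRatio (Set.Iio 1) ν)
    (h3 : IntegrableOn aRatio' (Set.Ioi 1) ν)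
    (h4 : ∫ α, aRatio α ∂ν ≤ -1)
    (hconv : ∀ d : ℕ, ConvexOn ℝ {x : Fin d → ℝ | (∀ i, 0 ≤ x i) ∧ x ≠ 0}
      (fun x => (∑ i, x i) * exp2 (-∫ α, renyi α (fun i => x i / ∑ j, x j) ∂ν))) :
    ∃ αstar : ℝ≥0∞, 1 < αstar ∧ ν {α | 1 < α ∧ α ≠ αstar} = 0 := by
  by_contra hcon
  obtain ⟨b, c, hb, hbc, hνb, hνc, hp, hq⟩ := exists_split ν hcon
  have hA := integrable_aRatio ν h1 h2 h3
  have hb1 : (1 : ℝ≥0∞) < ENNReal.ofReal b := by simpa using hb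
  have hc1 : (1 : ℝ≥0∞) < ENNReal.ofReal c := by simpa using hb.trans hbc
  have hP := theta_pos ν hA _ measurableSet_Ioo (fun α hα => hb1.trans hα.1) hp
  have hQ := theta_pos ν hA _ measurableSet_Ioi (fun α hα => hc1.trans hα) hq
  set p := ∫ α in Set.Ioo (ENNReal.ofReal b) (ENNReal.ofReal c), -aRatio α ∂ν with hpdef
  set q := ∫ α in Set.Ioi (ENNReal.ofReal c), -aRatio α ∂ν with hqdef
  have key : ∀ s : ℝ, s ≠ 0 → |s * q| ≤ 1 / 2 → |s * p| ≤ 1 / 2 →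
      ∀ᶠ n in atTop, LL ν (tv b c n (1 + s * q) (1 - s * p)) - LL ν (tv b c n 1 1) < 0 := by
    intro s hs hsq hsp
    rw [abs_le] at hsq hsp
    have hl := LL_lim ν h1 hA b c (1 + s * q) (1 - s * p) hb hbc hνb hνc
      (by linarith) (by linarith) (by linarith) (by linarith)
    rw [prof_integral ν hA b c _ _ hb hbc hνb hνc] at hl
    exact hl.eventually (gt_mem_nhds
      (log_neg_aux p q s hP hQ hs (by linarith) (by linarith)))
  obtain ⟨s, hs, hsq, hsp⟩ : ∃ s : ℝ, 0 < s ∧ s * q ≤ 1 / 2 ∧ s * p ≤ 1 / 2 := by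
    refine ⟨1 / (2 * (p + q)), by positivity, ?_, ?_⟩
    · rw [div_mul_eq_mul_div, div_le_iff₀ (by positivity)]; linarith
    · rw [div_mul_eq_mul_div, div_le_iff₀ (by positivity)]; linarith
  have hsq0 : 0 < s * q := mul_pos hs hQ
  have hsp0 : 0 < s * p := mul_pos hs hP
  have k1 := key s hs.ne' (by rw [abs_of_pos hsq0]; exact hsq) (by rw [abs_of_pos hsp0]; exact hsp)
  have k2 := key (-s) (neg_ne_zero.2 hs.ne')
    (by rw [neg_mul, abs_neg, abs_of_pos hsq0]; exact hsq)
    (by rw [neg_mul, abs_neg, abs_of_pos hsp0]; exact hsp)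
  obtain ⟨n, g1, g2⟩ := (k1.and k2).exists
  have px := tv_pos b c n (1 + s * q) (1 - s * p) (by linarith) (by linarith)
  have py := tv_pos b c n (1 + -s * q) (1 - -s * p) (by linarith) (by linarith)
  have pz := tv_pos b c n 1 1 one_pos one_pos
  have hm := Phi_mid ν hconv _ _ (tv b c n 1 1) px py (by
    rintro (i | i | i) <;> simp only [tv, Sum.elim_inl, Sum.elim_inr] <;> ring)
  rw [Phi_eq ν _ px, Phi_eq ν _ py, Phi_eq ν _ pz] at hm
  have r1 := Real.rpow_lt_rpow_of_exponent_lt (x := 2) (by norm_num) (sub_neg.1 g1)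
  have r2 := Real.rpow_lt_rpow_of_exponent_lt (x := 2) (by norm_num) (sub_neg.1 g2)
  linarith
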